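/- Let n ≥ 4 be an integer and let p be a real number with 2n/(n−1) ≤ p < n. Set L_{n,p} = (p/n) ((p−1)/e)^{p−1} π^{p/2} ( Γ(n/2+1) / Γ(n(p−1)/p + 1) )^{p/n}. Then for every smooth function u : ℝⁿ → ℝ with compact support contained in the open unit ball Bⁿ, writing dV = (2/(1−|x|²))ⁿ dx, such that ∫_{Bⁿ} |u|^p dV = 1, one has ∫_{Bⁿ} |u|^p ln(|u|^p) dV ≤ (n/p) ln( L_{n,p} ( ∫_{Bⁿ} ((1−|x|²)/2)^p |∇u|^p dV − ((n−1)/p)^p ∫_{Bⁿ} |u|^p dV ) ). -/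

import Mathlib

open Real MeasureTheory

/-- The constant `L_{n,p}` in the optimal `Lᵖ`-Sobolev logarithmic inequality. -/
noncomputable def logSobolevConst (n : ℕ) (p : ℝ) : ℝ :=
  (p / (n : ℝ)) * ((p - 1) / Real.exp 1) ^ (p - 1) * π ^ (p / 2) *
    (Real.Gamma ((n : ℝ) / 2 + 1) / Real.Gamma ((n : ℝ) * (p - 1) / p + 1)) ^ (p / (n : ℝ))

/-- A uniform convexity estimate for the `p`-th power of the norm. -/
theorem add_norm_rpow_le {F : Type*} [NormedAddCommGroup F] [InnerProductSpace ℝ F]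
    {p : ℝ} (hp : 2 ≤ p) (a b : F) :
    ‖a‖ ^ p + p * ‖a‖ ^ (p - 2) * inner ℝ a b + 2 ^ (1 - p) * ‖b‖ ^ p ≤ ‖a + b‖ ^ p := by
  have hsq : ∀ x : F, ‖x‖ ^ p = (‖x‖ ^ 2) ^ (p / 2) := fun x => by
    rw [← rpow_natCast, ← rpow_mul (norm_nonneg _)]; congr 1; push_cast; ring
  have hp1 : 1 ≤ p / 2 := by linarith
  -- parallelogram identity and superadditivity of `t ↦ t ^ (p / 2)`
  have clarkson : ‖a + (1 / 2 : ℝ) • b‖ ^ p + ‖(1 / 2 : ℝ) • b‖ ^ p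
      ≤ (‖a‖ ^ p + ‖a + b‖ ^ p) / 2 := by
    have h1 := Real.add_rpow_le_rpow_add (sq_nonneg ‖a + (1 / 2 : ℝ) • b‖)
      (sq_nonneg ‖(1 / 2 : ℝ) • b‖) hp1
    have h2 : ‖a + (1 / 2 : ℝ) • b‖ ^ 2 + ‖(1 / 2 : ℝ) • b‖ ^ 2
        = (1 / 2) * ‖a‖ ^ 2 + (1 / 2) * ‖a + b‖ ^ 2 := by
      rw [norm_add_sq_real, norm_add_sq_real, norm_smul, inner_smul_right]
      norm_num
      ring
    have h3 := (convexOn_rpow hp1).2 (Set.mem_Ici.2 (sq_nonneg ‖a‖))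
      (Set.mem_Ici.2 (sq_nonneg ‖a + b‖)) (show (0 : ℝ) ≤ 1 / 2 by norm_num)
      (show (0 : ℝ) ≤ 1 / 2 by norm_num) (by norm_num)
    simp only [smul_eq_mul] at h3
    rw [hsq, hsq, hsq a, hsq (a + b)]
    rw [h2] at h1
    linarith
  have bern : ‖a‖ ^ p + p / 2 * ‖a‖ ^ (p - 2) * inner ℝ a b ≤ ‖a + (1 / 2 : ℝ) • b‖ ^ p := by
    rcases eq_or_ne a 0 with rfl | ha
    · have : (0 : ℝ) ^ p = 0 := zero_rpow (by linarith)
      simp only [norm_zero, this, inner_zero_left, mul_zero, add_zero]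
      positivity
    have hpos : 0 < ‖a‖ := norm_pos_iff.2 ha
    set s := ‖a + (1 / 2 : ℝ) • b‖ ^ 2 / ‖a‖ ^ 2 with hs
    have hs0 : 0 ≤ s := by positivity
    have h1 := one_add_mul_self_le_rpow_one_add (s := s - 1) (by linarith) hp1
    rw [add_sub_cancel] at h1
    have h2 : ‖a + (1 / 2 : ℝ) • b‖ ^ p = ‖a‖ ^ p * s ^ (p / 2) := by
      rw [hsq, hsq a, ← mul_rpow (by positivity) hs0, hs]
      congr 1; field_simp
    have h3 : ‖a + (1 / 2 : ℝ) • b‖ ^ 2 ≥ ‖a‖ ^ 2 + inner ℝ a b := by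
      rw [norm_add_sq_real, inner_smul_right]
      nlinarith [sq_nonneg ‖(1 / 2 : ℝ) • b‖]
    have h4 : ‖a‖ ^ p = ‖a‖ ^ (p - 2) * ‖a‖ ^ 2 := by
      rw [← rpow_natCast, ← rpow_add hpos]; norm_num
    have h5 : inner ℝ a b / ‖a‖ ^ 2 ≤ s - 1 := by
      rw [hs, div_le_iff₀ (by positivity)]; field_simp; linarith
    have h6 : ‖a‖ ^ p * (p / 2 * (inner ℝ a b / ‖a‖ ^ 2))
        = p / 2 * ‖a‖ ^ (p - 2) * inner ℝ a b := by
      rw [h4]; field_simp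
    rw [h2]
    calc _ = ‖a‖ ^ p * (1 + p / 2 * (inner ℝ a b / ‖a‖ ^ 2)) := by rw [mul_add, h6]; ring
      _ ≤ ‖a‖ ^ p * (1 + p / 2 * (s - 1)) := by gcongr
      _ ≤ _ := by gcongr
  have hb : ‖(1 / 2 : ℝ) • b‖ ^ p = 2 ^ (1 - p) / 2 * ‖b‖ ^ p := by
    rw [norm_smul, mul_rpow (by positivity) (by positivity), rpow_sub (by norm_num), norm_div,
      norm_one, div_rpow (by norm_num) (by norm_num), norm_two, one_rpow, rpow_one]
    field_simp
  rw [hb] at clarkson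
  linarith

theorem Gamma_add_one_le_mul_rpow {a x : ℝ} (ha : 0 ≤ a) (hx : a < x) :
    Gamma (x + 1) ≤ Gamma (a + 1) * (x + 1) ^ (x - a) := by
  have h := convexOn_log_Gamma.slope_mono_adjacent (x := a + 1) (y := x + 1) (z := x + 2)
    (Set.mem_Ioi.2 (by linarith)) (Set.mem_Ioi.2 (by linarith)) (by linarith) (by linarith)
  have hG : 0 < Gamma (x + 1) := Gamma_pos_of_pos (by linarith)
  have hGa : 0 < Gamma (a + 1) := Gamma_pos_of_pos (by linarith)
  have h1 : log (Gamma (x + 2)) = log (x + 1) + log (Gamma (x + 1)) := by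
    rw [show x + 2 = x + 1 + 1 by ring, Gamma_add_one (by linarith),
      log_mul (by linarith) hG.ne']
  simp only [Function.comp, h1] at h
  rw [show x + 2 - (x + 1) = 1 by ring, show x + 1 - (a + 1) = x - a by ring,
    div_le_iff₀ (by linarith)] at h
  have hx0 : 0 < x + 1 := by linarith
  rw [← log_le_log_iff hG (by positivity), log_mul hGa.ne' (by positivity), log_rpow hx0]
  linarith

theorem rpow_mul_two_rpow_le_logSobolevConst {n : ℕ} {p : ℝ} (hp : 2 < p) (hpn : p ≤ n) :
    (p ^ 2 / (12 * n)) ^ (p / 2) * 2 ^ (p - 1) ≤ logSobolevConst n p := by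
  have hn : (0 : ℝ) < n := by linarith
  have hp0 : 0 < p := by linarith
  have hp1 : 0 < p - 1 := by linarith
  set x : ℝ := n * (p - 1) / p with hx
  have hxn : (n : ℝ) / 2 < x := by
    rw [hx, div_lt_div_iff₀ (by norm_num) hp0]; nlinarith
  have hx1 : x + 1 ≤ n := by
    rw [hx, ← le_sub_iff_add_le, div_le_iff₀ hp0]; nlinarith
  have hx0 : 0 < x + 1 := by linarith
  have hG : 0 < Gamma (x + 1) := Gamma_pos_of_pos hx0
  have hGa : 0 < Gamma ((n : ℝ) / 2 + 1) := Gamma_pos_of_pos (by positivity)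
  have h1 := log_le_log hG (Gamma_add_one_le_mul_rpow (by positivity) hxn)
  rw [log_mul hGa.ne' (by positivity), log_rpow hx0] at h1
  have h2 : (x - n / 2) * log (x + 1) ≤ (x - n / 2) * log n := by
    have := log_le_log hx0 hx1
    gcongr
  have h3 : (p - 1) * (log p - log (p - 1)) ≤ 1 := by
    rw [← log_div (by positivity) (by positivity)]
    have := log_le_sub_one_of_pos (show 0 < p / (p - 1) by positivity)
    calc (p - 1) * log (p / (p - 1)) ≤ (p - 1) * (p / (p - 1) - 1) := by gcongr
      _ = 1 := by field_simp; ring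
  have h4 : 2 + 2 * log 2 ≤ log 12 + log π := by
    have he : exp 1 < 2.7182818286 := exp_one_lt_d9
    have hpi : 3 < π := pi_gt_three
    rw [← log_mul (by norm_num) (by positivity), le_log_iff_exp_le (by positivity), exp_add,
      show (2 : ℝ) * log 2 = log 2 + log 2 by ring, exp_add, exp_log (by norm_num),
      show (2 : ℝ) = 1 + 1 by norm_num, exp_add]
    nlinarith [exp_pos 1]
  have h5 : 0 < log 2 := log_pos (by norm_num)
  rw [logSobolevConst, ← hx]
  rw [← log_le_log_iff (by positivity) (by positivity)]
  rw [log_mul (by positivity) (by positivity), log_mul (by positivity) (by positivity),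
    log_mul (by positivity) (by positivity), log_mul (by positivity) (by positivity),
    log_rpow (by positivity), log_rpow (by positivity), log_rpow (by positivity),
    log_rpow (by positivity), log_rpow (by positivity), log_div (by positivity) (by positivity),
    log_div (by positivity) (by positivity), log_div (by positivity) (by positivity),
    log_div (by positivity) (by positivity), log_mul (by positivity) (by positivity), log_pow,
    log_exp]
  have h6 : p / n * (log (Gamma (x + 1)) - log (Gamma ((n : ℝ) / 2 + 1)))
      ≤ (p / 2 - 1) * log n := by
    calc _ ≤ p / n * ((x - n / 2) * log n) := by gcongr; linarith
      _ = _ := by rw [hx]; field_simp; ring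
  push_cast
  nlinarith [h6, h3, mul_le_mul_of_nonneg_left h4 hp0.le]

/-- A one-dimensional bound for the mean of `N` under the density proportional to `g`. -/
theorem integral_mul_div_le_of_sq_deriv_le {g N A D : ℝ → ℝ} (hg : Continuous g)
    (hA : Continuous A) (hD : Continuous D) (hgs : HasCompactSupport g)
    (hNs : HasCompactSupport N) (hAs : HasCompactSupport A) (hg0 : 0 ≤ g) (hA0 : 0 ≤ A)
    (hN : ∀ t, HasDerivAt N (D t) t) (hDA : ∀ t, D t ^ 2 ≤ 4 * A t * g t) {α : ℝ} (hα : 0 < α)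
    (hm : 0 < ∫ t, g t) :
    ∫ t, N t * g t / (∫ s, g s) ≤ ∫ t, (α * A t + g t / (12 * α)) := by
  have hNc : Continuous N := continuous_iff_continuousAt.2 fun t => (hN t).continuousAt
  obtain ⟨R, hR⟩ : ∃ R : ℝ, Function.support g ∪ Function.support N ∪ Function.support A
      ⊆ Set.Ioo (-R) R := by
    have hb := ((hgs.isBounded.union hNs.isBounded).union hAs.isBounded).subset_ball 0
    obtain ⟨R, hR⟩ := hb
    refine ⟨R, fun x hx => ?_⟩
    have := hR (Set.union_subset_union (Set.union_subset_union (subset_tsupport g)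
      (subset_tsupport N)) (subset_tsupport A) hx)
    rwa [Real.ball_eq_Ioo, zero_sub, zero_add] at this
  have hgR : Function.support g ⊆ Set.Ioo (-R) R := fun x hx => hR (Or.inl (Or.inl hx))
  have hNR : Function.support N ⊆ Set.Ioo (-R) R := fun x hx => hR (Or.inl (Or.inr hx))
  have hAR : Function.support A ⊆ Set.Ioo (-R) R := fun x hx => hR (Or.inr hx)
  have conv : ∀ f : ℝ → ℝ, Function.support f ⊆ Set.Ioo (-R) R →
      ∫ t, f t = ∫ t in (-R)..R, f t := fun f hf =>
    (intervalIntegral.integral_eq_integral_of_support_subset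
      (hf.trans Set.Ioo_subset_Ioc_self)).symm
  have hR0 : -R ≤ R := by
    by_contra h
    rw [Set.Ioo_eq_empty (by linarith)] at hgR
    have : g = 0 := Function.support_eq_empty_iff.1 (Set.subset_empty_iff.1 hgR)
    simp [this] at hm
  set m := ∫ s, g s with hmdef
  set T : ℝ → ℝ := fun t => (∫ s in (-R)..t, g s) / m - 1 / 2 with hT
  have hTd : ∀ t, HasDerivAt T (g t / m) t := fun t =>
    ((intervalIntegral.integral_hasDerivAt_right (hg.intervalIntegrable _ _)
      (hg.stronglyMeasurableAtFilter _ _) hg.continuousAt).div_const m).sub_const _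
  have hTc : Continuous T := continuous_iff_continuousAt.2 fun t => (hTd t).continuousAt
  have hT1 : T (-R) = -1 / 2 := by simp [hT]; ring
  have hT2 : T R = 1 / 2 := by
    simp only [hT]; rw [← conv g hgR, ← hmdef, div_self hm.ne']; norm_num
  have hNend : N (-R) = 0 ∧ N R = 0 := by
    constructor <;> (by_contra h; have := hNR (Function.mem_support.2 h); simp at this)
  have parts := intervalIntegral.integral_mul_deriv_eq_deriv_mul (a := -R) (b := R)
    (fun t _ => hN t) (fun t _ => hTd t) (hD.intervalIntegrable _ _)
    ((hg.div_const m).intervalIntegrable _ _)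
  have cube := intervalIntegral.integral_eq_sub_of_hasDerivAt (a := -R) (b := R)
    (f := fun t => m / 3 * T t ^ 3) (f' := fun t => g t * T t ^ 2)
    (fun t _ => by
      refine (((hTd t).pow 3).const_mul (m / 3)).congr_deriv ?_
      push_cast
      field_simp)
    ((hg.mul (hTc.pow 2)).intervalIntegrable _ _)
  rw [conv _ (fun t ht => hNR fun h => ht (by simp [h])),
    conv _ (fun t ht => by
      by_contra h
      have h1 : A t = 0 := by by_contra h'; exact h (hAR h')
      have h2 : g t = 0 := by by_contra h'; exact h (hgR h')
      simp [h1, h2] at ht)]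
  calc ∫ t in (-R)..R, N t * g t / m = ∫ t in (-R)..R, N t * (g t / m) := by
        simp only [mul_div_assoc]
    _ = ∫ t in (-R)..R, -(D t * T t) := by
        rw [parts, hNend.1, hNend.2, intervalIntegral.integral_neg]; ring
    _ ≤ ∫ t in (-R)..R, (α * A t + g t * T t ^ 2 / α) := by
        refine intervalIntegral.integral_mono_on hR0
          ((hD.mul hTc).neg.intervalIntegrable _ _)
          (((hA.const_mul α).add ((hg.mul (hTc.pow 2)).div_const α)).intervalIntegrable _ _)
          fun t _ => ?_
        refine (neg_le_abs _).trans (abs_le_of_sq_le_sq ?_ ?_)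
        · have hgt := hg0 t
          have hAt := hA0 t
          have e : α * A t * (g t * T t ^ 2 / α) = A t * g t * T t ^ 2 := by field_simp
          nlinarith [sq_nonneg (α * A t - g t * T t ^ 2 / α),
            mul_le_mul_of_nonneg_right (hDA t) (sq_nonneg (T t))]
        · have hgt := hg0 t
          have hAt := hA0 t
          simp only [Pi.zero_apply] at hgt hAt
          positivity
    _ = ∫ t in (-R)..R, (α * A t + g t / (12 * α)) := by
        rw [intervalIntegral.integral_add ((hA.const_mul α).intervalIntegrable _ _)
            ((show Continuous fun t => g t * T t ^ 2 / α by fun_prop).intervalIntegrable _ _),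
          intervalIntegral.integral_add ((hA.const_mul α).intervalIntegrable _ _)
            ((hg.div_const _).intervalIntegrable _ _),
          intervalIntegral.integral_div, intervalIntegral.integral_div, cube, hT1, hT2,
          ← conv g hgR, ← hmdef]
        field_simp
        ring

/-- The logarithm of `N ^ n / P ^ (n - 1)` is bounded through line integrals of `P`. -/
theorem mul_log_sub_log_le {ι : Type*} [Fintype ι] (hι : 2 ≤ Fintype.card ι) {P N c : ℝ}
    {Q : ι → ℝ} (hP : 0 < P)
    (hN : 0 < N) (hQ : ∀ i, 0 < Q i) (hc : 0 < c) :
    P * (Fintype.card ι * log N - (Fintype.card ι - 1) * log P) ≤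
      c * (∑ i, N * P / Q i) + (Fintype.card ι - 1) * ∏ i, Q i ^ (1 / ((Fintype.card ι : ℝ) - 1))
        - (2 * Fintype.card ι - 1 + Fintype.card ι * log c) * P := by
  have hcard : (2 : ℝ) ≤ Fintype.card ι := by exact_mod_cast hι
  have hk : (0 : ℝ) < (Fintype.card ι : ℝ) - 1 := by linarith
  set k : ℝ := (Fintype.card ι : ℝ) with hkdef
  have h1 : ∑ i, log (c * N / Q i) ≤ ∑ i, (c * N / Q i - 1) :=
    Finset.sum_le_sum fun i _ => log_le_sub_one_of_pos (div_pos (mul_pos hc hN) (hQ i))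
  have h2 : ∑ i, log (c * N / Q i) = k * log c + k * log N - ∑ i, log (Q i) := by
    rw [Finset.sum_congr rfl fun i _ => by
      rw [log_div (mul_pos hc hN).ne' (hQ i).ne', log_mul hc.ne' hN.ne']]
    simp [Finset.sum_sub_distrib, ← hkdef]
  have hprod : 0 < ∏ i, Q i ^ (1 / (k - 1)) :=
    Finset.prod_pos fun i _ => rpow_pos_of_pos (hQ i) _
  have h3 := log_le_sub_one_of_pos (div_pos hprod hP)
  have h4 : log (∏ i, Q i ^ (1 / (k - 1))) = 1 / (k - 1) * ∑ i, log (Q i) := by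
    rw [log_prod fun i _ => (rpow_pos_of_pos (hQ i) _).ne', Finset.mul_sum]
    exact Finset.sum_congr rfl fun i _ => log_rpow (hQ i) _
  rw [log_div hprod.ne' hP.ne', h4] at h3
  have h5 : ∑ i, log (Q i) - (k - 1) * log P
      ≤ (k - 1) * ((∏ i, Q i ^ (1 / (k - 1))) / P - 1) := by
    calc _ = (k - 1) * (1 / (k - 1) * ∑ i, log (Q i) - log P) := by field_simp
      _ ≤ _ := by gcongr
  have h6 : ∑ i, (c * N / Q i - 1) = c * (∑ i, N / Q i) - k := by
    simp [Finset.sum_sub_distrib, Finset.mul_sum, ← hkdef, mul_div_assoc]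
  have h7 : ∑ i, N * P / Q i = P * ∑ i, N / Q i := by
    rw [Finset.mul_sum]; exact Finset.sum_congr rfl fun i _ => by ring
  have h8 : P * ((k - 1) * ((∏ i, Q i ^ (1 / (k - 1))) / P - 1))
      = (k - 1) * (∏ i, Q i ^ (1 / (k - 1))) - (k - 1) * P := by
    field_simp
  rw [h7]
  have h9 := mul_le_mul_of_nonneg_left
    (show k * log N - (k - 1) * log P ≤ c * (∑ i, N / Q i) - k - k * log c +
      (k - 1) * ((∏ i, Q i ^ (1 / (k - 1))) / P - 1) by linarith) hP.le
  rw [mul_add, h8] at h9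
  linarith

section Slice

open Function

variable {ι : Type*} [DecidableEq ι]

/-- The integral of `P` over the line through `x` in the direction of the `i`-th coordinate. -/
noncomputable def sliceIntegral (P : (ι → ℝ) → ℝ) (i : ι) (x : ι → ℝ) : ℝ :=
  ∫ t, P (update x i t)

theorem HasCompactSupport.comp_update {f : (ι → ℝ) → ℝ} (hf : HasCompactSupport f) (x : ι → ℝ)
    (i : ι) : HasCompactSupport fun t => f (update x i t) :=
  hf.comp_isClosedEmbedding (isClosedEmbedding_update x i)

theorem Continuous.comp_update {f : (ι → ℝ) → ℝ} (hf : Continuous f) (x : ι → ℝ)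
    (i : ι) : Continuous fun t => f (Function.update x i t) :=
  hf.comp (continuous_const.update i continuous_id)

variable {P : (ι → ℝ) → ℝ}

theorem sliceIntegral_nonneg (hP0 : 0 ≤ P) (i : ι) (x : ι → ℝ) : 0 ≤ sliceIntegral P i x :=
  integral_nonneg fun _ => hP0 _

theorem sliceIntegral_update (i : ι) (x : ι → ℝ) (t : ℝ) :
    sliceIntegral P i (update x i t) = sliceIntegral P i x := by
  simp [sliceIntegral]


theorem ofReal_sliceIntegral (hP : Continuous P) (hPs : HasCompactSupport P) (hP0 : 0 ≤ P)
    (i : ι) (x : ι → ℝ) :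
    ENNReal.ofReal (sliceIntegral P i x) = ∫⁻ t, ENNReal.ofReal (P (update x i t)) :=
  ofReal_integral_eq_lintegral_ofReal
    ((hP.comp_update x i).integrable_of_hasCompactSupport (hPs.comp_update x i))
    (.of_forall fun _ => hP0 _)

theorem sliceIntegral_pos (hP : Continuous P) (hPs : HasCompactSupport P) (hP0 : 0 ≤ P)
    (i : ι) {x : ι → ℝ} (hx : 0 < P x) : 0 < sliceIntegral P i x :=
  (hP.comp_update x i).integral_pos_of_hasCompactSupport_nonneg_nonzero (x := x i)
    (hPs.comp_update x i) (fun _ => hP0 _) (by simpa using hx.ne')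

variable [Fintype ι]

theorem measurable_sliceIntegral (hP : Continuous P) (hPs : HasCompactSupport P) (hP0 : 0 ≤ P)
    (i : ι) : Measurable (sliceIntegral P i) := by
  have h : Measurable fun x => ∫⁻ t, ENNReal.ofReal (P (update x i t)) := by
    have := Measurable.lmarginal (s := {i}) (fun _ : ι => (volume : Measure ℝ))
      (show Measurable fun x => ENNReal.ofReal (P x) by fun_prop)
    rwa [lmarginal_singleton] at this
  have e : sliceIntegral P i = fun x => (∫⁻ t, ENNReal.ofReal (P (update x i t))).toReal := by
    ext x
    rw [← ofReal_sliceIntegral hP hPs hP0, ENNReal.toReal_ofReal (sliceIntegral_nonneg hP0 i x)]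
  rw [e]
  exact h.ennreal_toReal

/-- A function with finite integral of nonnegative values is integrable, with the bound
read off in `ℝ≥0∞`. -/
theorem integrable_and_integral_le_of_lintegral_le {X : Type*} [MeasurableSpace X]
    {μ : Measure X} {f : X → ℝ} (hf : Measurable f) (hf0 : 0 ≤ f) {b : ℝ} (hb : 0 ≤ b)
    (h : ∫⁻ x, ENNReal.ofReal (f x) ∂μ ≤ ENNReal.ofReal b) :
    Integrable f μ ∧ ∫ x, f x ∂μ ≤ b := by
  have hi : Integrable f μ := by
    refine ⟨hf.aestronglyMeasurable, ?_⟩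
    rw [hasFiniteIntegral_iff_ofReal (.of_forall hf0)]
    exact h.trans_lt ENNReal.ofReal_lt_top
  refine ⟨hi, ?_⟩
  rwa [← ENNReal.ofReal_le_ofReal_iff hb,
    ofReal_integral_eq_lintegral_ofReal hi (.of_forall hf0)]

/-- The Loomis–Whitney inequality for the line integrals of a probability density. -/
theorem prod_sliceIntegral_rpow_le (hι : 2 ≤ Fintype.card ι) (hP : Continuous P)
    (hPs : HasCompactSupport P) (hP0 : 0 ≤ P) (hP1 : ∫ x, P x = 1) :
    Integrable (fun x => ∏ i, sliceIntegral P i x ^ (1 / ((Fintype.card ι : ℝ) - 1))) ∧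
      ∫ x, ∏ i, sliceIntegral P i x ^ (1 / ((Fintype.card ι : ℝ) - 1)) ≤ 1 := by
  have hc : (2 : ℝ) ≤ Fintype.card ι := by exact_mod_cast hι
  refine integrable_and_integral_le_of_lintegral_le
    (Finset.measurable_fun_prod _ fun i _ =>
      (measurable_sliceIntegral hP hPs hP0 i).pow_const _)
    (fun x => Finset.prod_nonneg fun i _ => rpow_nonneg (sliceIntegral_nonneg hP0 i x) _)
    zero_le_one ?_
  have h := lintegral_prod_lintegral_pow_le (fun _ : ι => (volume : Measure ℝ))
    (Real.HolderConjugate.conjExponent (show (1 : ℝ) < Fintype.card ι by linarith))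
    (show Measurable fun x => ENNReal.ofReal (P x) by fun_prop)
  have h1 : ∫⁻ x, ENNReal.ofReal (P x) = 1 := by
    rw [← ofReal_integral_eq_lintegral_ofReal (hP.integrable_of_hasCompactSupport hPs)
      (.of_forall hP0), hP1, ENNReal.ofReal_one]
  rw [← volume_pi, h1, ENNReal.one_rpow] at h
  rw [ENNReal.ofReal_one]
  refine le_trans (le_of_eq (lintegral_congr fun x => ?_)) h
  rw [ENNReal.ofReal_prod_of_nonneg fun i _ => rpow_nonneg (sliceIntegral_nonneg hP0 i x) _]
  refine Finset.prod_congr rfl fun i _ => ?_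
  rw [← ofReal_sliceIntegral hP hPs hP0, ENNReal.ofReal_rpow_of_nonneg
    (sliceIntegral_nonneg hP0 i x)]
  exact one_div_nonneg.2 (by linarith)

theorem integral_mul_div_sliceIntegral_le {N A D : (ι → ℝ) → ℝ} {i : ι} (hP : Continuous P)
    (hPs : HasCompactSupport P) (hP0 : 0 ≤ P) (hP1 : ∫ x, P x = 1) (hNc : Continuous N)
    (hNs : HasCompactSupport N) (hN0 : 0 ≤ N) (hA : Continuous A) (hAs : HasCompactSupport A)
    (hA0 : 0 ≤ A) (hD : Continuous D)
    (hN : ∀ x t, HasDerivAt (fun t => N (update x i t)) (D (update x i t)) t)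
    (hDA : ∀ x, D x ^ 2 ≤ 4 * A x * P x) {α : ℝ} (hα : 0 < α) :
    Integrable (fun x => N x * P x / sliceIntegral P i x) ∧
      ∫ x, N x * P x / sliceIntegral P i x ≤ α * (∫ x, A x) + 1 / (12 * α) := by
  have hAi := hA.integrable_of_hasCompactSupport (μ := volume) hAs
  have hPi := hP.integrable_of_hasCompactSupport (μ := volume) hPs
  have hR0 : ∀ x, 0 ≤ α * A x + P x / (12 * α) := fun x => by
    have h1 := hA0 x
    have h2 := hP0 x
    simp only [Pi.zero_apply] at h1 h2
    positivity
  have hL0 : ∀ x, 0 ≤ N x * P x / sliceIntegral P i x := fun x =>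
    div_nonneg (mul_nonneg (hN0 x) (hP0 x)) (sliceIntegral_nonneg hP0 i x)
  have hLm : Measurable fun x => N x * P x / sliceIntegral P i x :=
    (hNc.measurable.mul hP.measurable).div (measurable_sliceIntegral hP hPs hP0 i)
  have hRint : ∫ x, (α * A x + P x / (12 * α)) = α * (∫ x, A x) + 1 / (12 * α) := by
    rw [integral_add (hAi.const_mul α) (hPi.div_const _), integral_const_mul, integral_div, hP1]
  refine integrable_and_integral_le_of_lintegral_le hLm hL0
    (hRint ▸ integral_nonneg hR0) ?_
  have hRi : Integrable fun x => α * A x + P x / (12 * α) :=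
    (hAi.const_mul α).add (hPi.div_const _)
  rw [← hRint, ofReal_integral_eq_lintegral_ofReal hRi (.of_forall hR0)]
  refine lintegral_le_of_lmarginal_le {i} hLm.ennreal_ofReal (by fun_prop) ?_
  rw [lmarginal_singleton, lmarginal_singleton]
  intro x
  dsimp only
  simp only [sliceIntegral_update]
  rcases (sliceIntegral_nonneg hP0 i x).eq_or_lt with h | h
  · simp [← h]
  have key := integral_mul_div_le_of_sq_deriv_le (hP.comp_update x i) (hA.comp_update x i)
    (hD.comp_update x i) (hPs.comp_update x i) (hNs.comp_update x i) (hAs.comp_update x i)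
    (fun _ => hP0 _) (fun _ => hA0 _) (hN x) (fun t => hDA _) hα h
  have hNP : HasCompactSupport fun t => N (update x i t) * P (update x i t) :=
    (hPs.comp_update x i).mul_left
  rw [← ofReal_integral_eq_lintegral_ofReal, ← ofReal_integral_eq_lintegral_ofReal]
  · exact ENNReal.ofReal_le_ofReal key
  · exact ((((hA.comp_update x i).integrable_of_hasCompactSupport
      (hAs.comp_update x i)).const_mul α).add
        (((hP.comp_update x i).integrable_of_hasCompactSupport (hPs.comp_update x i)).div_const _))
  · exact .of_forall fun _ => hR0 _
  · exact (((hNc.comp_update x i).mul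
      (hP.comp_update x i)).integrable_of_hasCompactSupport hNP).div_const _
  · exact .of_forall fun t => div_nonneg (mul_nonneg (hN0 _) (hP0 _)) h.le

/-- A logarithmic Sobolev inequality for probability densities on `ℝⁿ`, obtained from the
subadditivity of entropy and one-dimensional transport to the uniform measure. -/
theorem integral_mul_log_le (hι : 2 ≤ Fintype.card ι) {N : (ι → ℝ) → ℝ}
    {A D : ι → (ι → ℝ) → ℝ} (hP : Continuous P)
    (hPs : HasCompactSupport P) (hP0 : 0 ≤ P) (hP1 : ∫ x, P x = 1) (hNc : Continuous N)
    (hNs : HasCompactSupport N) (hN0 : 0 ≤ N) (hPN : ∀ x, 0 < P x → 0 < N x)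
    (hA : ∀ i, Continuous (A i)) (hAs : ∀ i, HasCompactSupport (A i))
    (hA0 : ∀ i, 0 ≤ A i) (hD : ∀ i, Continuous (D i))
    (hN : ∀ i x t, HasDerivAt (fun t => N (update x i t)) (D i (update x i t)) t)
    (hDA : ∀ i x, D i x ^ 2 ≤ 4 * A i x * P x) {α c : ℝ} (hα : 0 < α) (hc : 0 < c)
    (hPint : Integrable fun x =>
      P x * (Fintype.card ι * log (N x) - (Fintype.card ι - 1) * log (P x))) :
    ∫ x, P x * (Fintype.card ι * log (N x) - (Fintype.card ι - 1) * log (P x)) ≤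
      c * (α * (∑ i, ∫ x, A i x) + Fintype.card ι / (12 * α)) - Fintype.card ι
        - Fintype.card ι * log c := by
  have hcard : (2 : ℝ) ≤ Fintype.card ι := by exact_mod_cast hι
  have hslice := fun i => integral_mul_div_sliceIntegral_le hP hPs hP0 hP1 hNc hNs hN0 (hA i)
    (hAs i) (hA0 i) (hD i) (hN i) (hDA i) hα
  obtain ⟨hprod, hprod1⟩ := prod_sliceIntegral_rpow_le hι hP hPs hP0 hP1
  have hPi := hP.integrable_of_hasCompactSupport (μ := volume) hPs
  have hsum := integrable_finsetSum Finset.univ fun i _ => (hslice i).1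
  have hb1 : Integrable fun x => c * (∑ i, N x * P x / sliceIntegral P i x)
      + (Fintype.card ι - 1) * ∏ i, sliceIntegral P i x ^ (1 / ((Fintype.card ι : ℝ) - 1)) :=
    (hsum.const_mul c).add (hprod.const_mul ((Fintype.card ι : ℝ) - 1))
  have hb2 := hPi.const_mul (2 * Fintype.card ι - 1 + Fintype.card ι * log c)
  calc _ ≤ ∫ x, (c * (∑ i, N x * P x / sliceIntegral P i x)
        + (Fintype.card ι - 1) * ∏ i, sliceIntegral P i x ^ (1 / ((Fintype.card ι : ℝ) - 1))
        - (2 * Fintype.card ι - 1 + Fintype.card ι * log c) * P x) := by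
        refine integral_mono hPint (hb1.sub hb2) fun x => ?_
        rcases (hP0 x).eq_or_lt with h | h
        · simp only [Pi.zero_apply] at h
          simp only [← h, zero_mul, mul_zero, zero_div, Finset.sum_const_zero, zero_add, sub_zero]
          exact mul_nonneg (by linarith) (Finset.prod_nonneg fun i _ =>
            rpow_nonneg (sliceIntegral_nonneg hP0 i x) _)
        · exact mul_log_sub_log_le hι h (hPN x h)
            (fun i => sliceIntegral_pos hP hPs hP0 i h) hc
    _ = c * (∑ i, ∫ x, N x * P x / sliceIntegral P i x)
        + (Fintype.card ι - 1) *
          (∫ x, ∏ i, sliceIntegral P i x ^ (1 / ((Fintype.card ι : ℝ) - 1)))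
        - (2 * Fintype.card ι - 1 + Fintype.card ι * log c) := by
        rw [integral_sub hb1 hb2, integral_add (hsum.const_mul c) (hprod.const_mul _),
          integral_const_mul, integral_const_mul, integral_const_mul, hP1, mul_one,
          integral_finsetSum _ fun i _ => (hslice i).1]
    _ ≤ c * (∑ i, (α * (∫ x, A i x) + 1 / (12 * α))) + (Fintype.card ι - 1) * 1
        - (2 * Fintype.card ι - 1 + Fintype.card ι * log c) := by
        gcongr
        · exact (hslice _).2
        · linarith
    _ = _ := by
        rw [Finset.sum_add_distrib, ← Finset.mul_sum]
        simp
        ring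

end Slice

theorem HasFDerivAt.abs_rpow {E : Type*} [NormedAddCommGroup E] [NormedSpace ℝ E] {f : E → ℝ}
    {f' : E →L[ℝ] ℝ} {x : E} (hf : HasFDerivAt f f' x) {p : ℝ} (hp : 1 < p) :
    HasFDerivAt (fun w => |f w| ^ p) ((p * |f x| ^ (p - 2) * f x) • f') x :=
  (hasDerivAt_abs_rpow (f x) hp).comp_hasFDerivAt x hf

theorem tsupport_subset_of_imp {X α β : Type*} [TopologicalSpace X] [Zero α] [Zero β] {f : X → α}
    {g : X → β} (h : ∀ x, f x = 0 → g x = 0) : tsupport g ⊆ tsupport f :=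
  closure_mono fun x hx hf => hx (h x hf)

/-- Optimization of the free parameters in the entropy bound. -/
theorem le_log_add_of_forall_le {X K n p κ s : ℝ} (hn : 0 < n) (hp : 0 < p) (hκ : 0 < κ)
    (hX : ∀ α c : ℝ, 0 < α → 0 < c → X ≤ c * (α * K + n / (12 * α)) - n - n * log c)
    (hK : K ≤ p ^ 2 / 4 * κ ^ (2 / p) * (1 + 2 / p * s)) :
    X ≤ n / p * (log ((p ^ 2 / (12 * n)) ^ (p / 2) * κ) + s) := by
  set K₀ : ℝ := p ^ 2 / 4 * κ ^ (2 / p) with hK₀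
  have hK₀pos : 0 < K₀ := by positivity
  have hα : 0 < √(n / (12 * K₀)) := sqrt_pos.2 (by positivity)
  have hc : 0 < √(3 * n / K₀) := sqrt_pos.2 (by positivity)
  have h := hX _ _ hα hc
  set α := √(n / (12 * K₀)) with hα'
  set c := √(3 * n / K₀) with hc'
  have hc6 : c = 6 * α := by
    rw [hc', hα', show 3 * n / K₀ = 6 ^ 2 * (n / (12 * K₀)) by field_simp; norm_num,
      sqrt_mul (by norm_num), sqrt_sq (by norm_num)]
  have hαsq : α ^ 2 * K₀ = n / 12 := by
    rw [hα', sq_sqrt (by positivity)]; field_simp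
  have h1 : c * (α * K + n / (12 * α)) ≤ n / 2 * (1 + 2 / p * s) + n / 2 := by
    calc c * (α * K + n / (12 * α)) = 6 * α ^ 2 * K + n / 2 := by
          rw [hc6]; field_simp; ring
      _ ≤ 6 * α ^ 2 * (K₀ * (1 + 2 / p * s)) + n / 2 := by gcongr
      _ = 6 * (α ^ 2 * K₀) * (1 + 2 / p * s) + n / 2 := by ring
      _ = _ := by rw [hαsq]; ring
  have h2 : log c = - (1 / p) * log ((p ^ 2 / (12 * n)) ^ (p / 2) * κ) := by
    rw [hc', sqrt_eq_rpow, log_rpow (by positivity), hK₀, log_mul (by positivity) hκ.ne',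
      log_rpow (by positivity), log_div (by positivity) (by positivity), log_mul (by positivity)
      (by positivity), log_div (by positivity) (by positivity), log_mul (by norm_num) hn.ne',
      log_mul (by positivity) (by positivity), log_rpow hκ, log_div (by positivity) (by norm_num),
      show (12 : ℝ) = 3 * 4 by norm_num, log_mul (by norm_num) (by norm_num)]
    field_simp
    ring
  rw [h2] at h
  calc X ≤ _ := h
    _ ≤ n / 2 * (1 + 2 / p * s) + n / 2 - n
        - n * (- (1 / p) * log ((p ^ 2 / (12 * n)) ^ (p / 2) * κ)) := by gcongr
    _ = _ := by field_simp; ring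

/-- Young's inequality in the form that compares the two energies of the half-space. -/
theorem rpow_mul_sq_mul_le {p κ a d y : ℝ} (hp : 2 < p) (hκ : 0 < κ) (ha : 0 ≤ a) (hd : 0 ≤ d)
    (hy : 0 < y) :
    a ^ (p - 2) * d ^ 2 * y ≤
      κ ^ (2 / p) * ((1 - 2 / p) * (a ^ p / y) + 2 / p * (y ^ (p - 1) * d ^ p / κ)) := by
  have hp0 : 0 < p := by linarith
  have h := geom_mean_le_arith_mean2_weighted (w₁ := 1 - 2 / p) (w₂ := 2 / p) (p₁ := a ^ p / y)
    (p₂ := y ^ (p - 1) * d ^ p / κ) (sub_nonneg.2 ((div_le_one hp0).2 hp.le)) (by positivity)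
    (by positivity) (by positivity) (by ring)
  refine le_trans (le_of_eq ?_) (mul_le_mul_of_nonneg_left h (by positivity))
  rw [div_rpow (by positivity) hy.le, div_rpow (by positivity) hκ.le,
    mul_rpow (by positivity) (by positivity), ← rpow_mul ha, ← rpow_mul hd, ← rpow_mul hy.le,
    show p * (1 - 2 / p) = p - 2 by field_simp, show p * (2 / p) = (2 : ℕ) by field_simp; norm_num,
    rpow_natCast, show (p - 1) * (2 / p) = 1 + (1 - 2 / p) by field_simp; ring, rpow_add hy,
    rpow_one]
  have := rpow_pos_of_pos hy (1 - 2 / p)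
  have := rpow_pos_of_pos hκ (2 / p)
  field_simp

/-- The logarithmic Sobolev inequality `integral_mul_log_le` on Euclidean space. -/
theorem integral_mul_log_le_euclidean {ι : Type*} [DecidableEq ι] [Fintype ι]
    (hι : 2 ≤ Fintype.card ι) {P N : EuclideanSpace ℝ ι → ℝ} {A : ι → EuclideanSpace ℝ ι → ℝ}
    {D : EuclideanSpace ℝ ι → EuclideanSpace ℝ ι →L[ℝ] ℝ} (hP : Continuous P)
    (hPs : HasCompactSupport P) (hP0 : 0 ≤ P) (hP1 : ∫ x, P x = 1)
    (hNs : HasCompactSupport N) (hN0 : 0 ≤ N) (hPN : ∀ x, 0 < P x → 0 < N x)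
    (hA : ∀ i, Continuous (A i)) (hAs : ∀ i, HasCompactSupport (A i))
    (hA0 : ∀ i, 0 ≤ A i) (hD : Continuous D) (hN : ∀ x, HasFDerivAt N (D x) x)
    (hDA : ∀ i x, D x (EuclideanSpace.single i 1) ^ 2 ≤ 4 * A i x * P x)
    {α c : ℝ} (hα : 0 < α) (hc : 0 < c)
    (hPint : Integrable fun x =>
      P x * (Fintype.card ι * log (N x) - (Fintype.card ι - 1) * log (P x))) :
    ∫ x, P x * (Fintype.card ι * log (N x) - (Fintype.card ι - 1) * log (P x)) ≤
      c * (α * (∑ i, ∫ x, A i x) + Fintype.card ι / (12 * α)) - Fintype.card ι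
        - Fintype.card ι * log c := by
  let T : (ι → ℝ) ≃L[ℝ] EuclideanSpace ℝ ι := (EuclideanSpace.equiv ι ℝ).symm
  have hTs : ∀ {f : EuclideanSpace ℝ ι → ℝ}, HasCompactSupport f → HasCompactSupport (f ∘ T) :=
    fun h => h.comp_homeomorph T.toHomeomorph
  have hNc : Continuous N := continuous_iff_continuousAt.2 fun x => (hN x).continuousAt
  have hm := (MeasurableEquiv.toLp 2 (ι → ℝ)).measurableEmbedding
  have hmp := PiLp.volume_preserving_toLp ι
  have hTint : ∀ f : EuclideanSpace ℝ ι → ℝ, ∫ x, f (T x) = ∫ z, f z := hmp.integral_comp hm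
  have h := integral_mul_log_le hι (P := P ∘ T) (N := N ∘ T)
    (A := fun i => A i ∘ T) (D := fun i x => D (T x) (EuclideanSpace.single i 1))
    (hP.comp T.continuous) (hTs hPs) (fun x => hP0 _) ((hTint P).trans hP1)
    (hNc.comp T.continuous) (hTs hNs) (fun x => hN0 _) (fun x hx => hPN _ hx)
    (fun i => (hA i).comp T.continuous) (fun i => hTs (hAs i)) (fun i x => hA0 i _)
    (fun i => (hD.comp T.continuous).clm_apply continuous_const)
    (fun i x t => (hN (T (Function.update x i t))).comp_hasDerivAt t
        (T.hasFDerivAt.comp_hasDerivAt t (hasDerivAt_update x i t)))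
    (fun i x => hDA i _) hα hc ((hmp.integrable_comp_emb hm).2 hPint)
  rw [← hTint]
  simp only [← hTint (A _)]
  exact h

/-- If `f` is continuous on an open set containing its topological support, it is continuous. -/
theorem continuous_of_forall_pos {ι : Type*} {f : EuclideanSpace ℝ ι → ℝ} {i₀ : ι}
    (hs : ∀ z ∈ tsupport f, 0 < z i₀)
    (h : ∀ z : EuclideanSpace ℝ ι, 0 < z i₀ → ContinuousAt f z) : Continuous f :=
  continuous_of_tsupport fun z hz => h z (hs z hz)

/-- A logarithmic Sobolev inequality on the half-space, with the weights that come from the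
hyperbolic metric. -/
theorem integral_halfSpace_mul_log_le {ι : Type*} [Fintype ι] (hι : 2 ≤ Fintype.card ι) {p : ℝ}
    (hp : 2 < p) (i₀ : ι) {v : EuclideanSpace ℝ ι → ℝ} (hv : ContDiff ℝ 1 v)
    (hvs : HasCompactSupport v) (hpos : ∀ z ∈ tsupport v, 0 < z i₀)
    (h1 : ∫ z, |v z| ^ p / z i₀ = 1) {κ : ℝ} (hκ : 0 < κ) :
    ∫ z, |v z| ^ p / z i₀ * (log (|v z| ^ p) + (Fintype.card ι - 1) * log (z i₀)) ≤
      Fintype.card ι / p * (log ((p ^ 2 / (12 * Fintype.card ι)) ^ (p / 2) * κ)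
        + (∫ z, z i₀ ^ (p - 1) * ‖fderiv ℝ v z‖ ^ p) / κ - 1) := by
  classical
  have hn : (2 : ℝ) ≤ Fintype.card ι := by exact_mod_cast hι
  set n : ℝ := (Fintype.card ι : ℝ) with hndef
  have hp0 : 0 < p := by linarith
  have hv0 : ∀ z : EuclideanSpace ℝ ι, z i₀ ≤ 0 → v z = 0 := fun z hz =>
    image_eq_zero_of_notMem_tsupport fun h => (hpos z h).not_ge hz
  have hdv0 : ∀ z : EuclideanSpace ℝ ι, z i₀ ≤ 0 → fderiv ℝ v z = 0 := fun z hz =>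
    fderiv_of_notMem_tsupport _ fun h => (hpos z h).not_ge hz
  have hsub : ∀ {f : EuclideanSpace ℝ ι → ℝ}, (∀ z, v z = 0 → f z = 0) → tsupport f ⊆ tsupport v :=
    fun h => tsupport_subset_of_imp h
  have hvc := hv.continuous
  have hdvc : Continuous (fderiv ℝ v) := hv.continuous_fderiv one_ne_zero
  let P : EuclideanSpace ℝ ι → ℝ := fun z => |v z| ^ p / z i₀
  let A : ι → EuclideanSpace ℝ ι → ℝ := fun i z =>
    p ^ 2 / 4 * (|v z| ^ (p - 2) * fderiv ℝ v z (EuclideanSpace.single i 1) ^ 2 * z i₀)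
  let D : EuclideanSpace ℝ ι → EuclideanSpace ℝ ι →L[ℝ] ℝ := fun z =>
    (p * |v z| ^ (p - 2) * v z) • fderiv ℝ v z
  have habs : ∀ q : ℝ, 0 < q → Continuous fun z => |v z| ^ q := fun q hq =>
    hvc.abs.rpow_const fun _ => .inr hq.le
  have hPs : ∀ z, v z = 0 → P z = 0 := fun z hz => by simp [P, hz, hp0.ne']
  have hPc : Continuous P := continuous_of_forall_pos (i₀ := i₀)
    (fun z hz => hpos z (hsub hPs hz)) fun z hz =>
    (habs p hp0).continuousAt.div (by fun_prop) hz.ne'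
  have hP0 : ∀ z, 0 ≤ P z := fun z => by
    rcases le_or_gt (z i₀) 0 with hz | hz
    · rw [hPs z (hv0 z hz)]
    · positivity
  have hAc : ∀ i, Continuous (A i) := fun i =>
    (((habs _ (by linarith)).mul ((hdvc.clm_apply continuous_const).pow 2)).mul
      (by fun_prop)).const_mul _
  have hA0 : ∀ i z, 0 ≤ A i z := fun i z => by
    rcases le_or_gt (z i₀) 0 with hz | hz
    · simp [A, hdv0 z hz]
    · positivity
  have hDc : Continuous D := (((habs _ (by linarith)).const_mul p).mul hvc).smul hdvc
  have hAs : ∀ i, HasCompactSupport (A i) := fun i =>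
    hvs.mono fun z hz hvz => hz (by simp [A, hvz, (by linarith : p - 2 ≠ 0)])
  have hNd : ∀ z, HasFDerivAt (fun z => |v z| ^ p) (D z) z :=
    fun z => (hasDerivAt_abs_rpow (v z) (by linarith)).comp_hasFDerivAt z
      (hv.differentiable one_ne_zero z).hasFDerivAt
  have hDA : ∀ i z, D z (EuclideanSpace.single i 1) ^ 2 ≤ 4 * A i z * P z := fun i z => by
    rcases le_or_gt (z i₀) 0 with hz | hz
    · simp [D, A, hdv0 z hz]
    · have h : |v z| ^ p = |v z| ^ (p - 2) * v z ^ 2 := by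
        rcases eq_or_ne (v z) 0 with h | h
        · simp [h, hp0.ne']
        · rw [← sq_abs (v z), ← rpow_natCast |v z|, ← rpow_add (abs_pos.2 h)]
          simp
      refine le_of_eq ?_
      simp only [D, A, P, h, smul_apply, smul_eq_mul]
      field_simp
  have hFc : Continuous fun z : EuclideanSpace ℝ ι =>
      |v z| ^ p / z i₀ * (log (|v z| ^ p) + (n - 1) * log (z i₀)) :=
    continuous_of_forall_pos (i₀ := i₀)
      (fun z hz => hpos z (hsub (fun z hz => by simp [hz, hp0.ne']) hz)) fun z hz => by
      have h : ContinuousAt (fun z : EuclideanSpace ℝ ι => |v z| ^ p * log (|v z| ^ p) / z i₀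
          + (n - 1) * (log (z i₀) * P z)) z :=
        ((continuous_mul_log.comp (habs p hp0)).continuousAt.div (by fun_prop) hz.ne').add
          ((((by fun_prop : ContinuousAt (fun z : EuclideanSpace ℝ ι => z i₀) z).log hz.ne').mul
            hPc.continuousAt).const_mul _)
      refine h.congr (.of_forall fun w => ?_)
      simp only [P]
      ring
  have hFs : HasCompactSupport fun z : EuclideanSpace ℝ ι =>
      |v z| ^ p / z i₀ * (log (|v z| ^ p) + (n - 1) * log (z i₀)) :=
    hvs.mono fun z hz hvz => hz (by simp [hvz, hp0.ne'])
  have hFP : ∀ z : EuclideanSpace ℝ ι, |v z| ^ p / z i₀ * (log (|v z| ^ p) + (n - 1) * log (z i₀))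
      = P z * (n * log (|v z| ^ p) - (n - 1) * log (P z)) := fun z => by
    rcases eq_or_ne (v z) 0 with h | h
    · simp [P, h, hp0.ne']
    · have hz : 0 < z i₀ := not_le.1 fun hz => h (hv0 z hz)
      simp only [P]
      rw [log_div (rpow_pos_of_pos (abs_pos.2 h) _).ne' hz.ne']
      ring
  have hEc : Continuous fun z : EuclideanSpace ℝ ι => z i₀ ^ (p - 1) * ‖fderiv ℝ v z‖ ^ p :=
    ((by fun_prop : Continuous fun z : EuclideanSpace ℝ ι => z i₀).rpow_const
      fun _ => .inr (by linarith)).mul (hdvc.norm.rpow_const fun _ => .inr hp0.le)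
  have hEs : HasCompactSupport fun z : EuclideanSpace ℝ ι => z i₀ ^ (p - 1) * ‖fderiv ℝ v z‖ ^ p :=
    (hvs.fderiv ℝ).mono fun z hz hvz => hz (by simp [hvz, hp0.ne'])
  have hEi := hEc.integrable_of_hasCompactSupport (μ := volume) hEs
  have hPcs : HasCompactSupport P := hvs.mono fun z hz hvz => hz (hPs z hvz)
  have hPi := hPc.integrable_of_hasCompactSupport (μ := volume) hPcs
  have hAi := fun i => (hAc i).integrable_of_hasCompactSupport (μ := volume) (hAs i)
  have hK : ∑ i, ∫ z, A i z ≤ p ^ 2 / 4 * κ ^ (2 / p) *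
      (1 + 2 / p * ((∫ z : EuclideanSpace ℝ ι, z i₀ ^ (p - 1) * ‖fderiv ℝ v z‖ ^ p) / κ - 1)) := by
    rw [← integral_finsetSum _ fun i _ => hAi i]
    calc ∫ z, ∑ i, A i z ≤ ∫ z, p ^ 2 / 4 * κ ^ (2 / p) * ((1 - 2 / p) * P z
          + 2 / p * (z i₀ ^ (p - 1) * ‖fderiv ℝ v z‖ ^ p / κ)) := by
          refine integral_mono (integrable_finsetSum _ fun i _ => hAi i)
            (((hPi.const_mul _).add ((hEi.div_const _).const_mul _)).const_mul _) fun z => ?_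
          rcases le_or_gt (z i₀) 0 with hz | hz
          · simp [A, P, hv0 z hz, hdv0 z hz, hp0.ne']
          · have h := rpow_mul_sq_mul_le hp hκ (abs_nonneg (v z)) (norm_nonneg (fderiv ℝ v z)) hz
            have hnorm : ∑ i, fderiv ℝ v z (EuclideanSpace.single i 1) ^ 2
                = ‖fderiv ℝ v z‖ ^ 2 := by
              rw [← (InnerProductSpace.toDual ℝ _).symm.norm_map, EuclideanSpace.norm_sq_eq]
              refine Finset.sum_congr rfl fun i _ => ?_
              rw [norm_eq_abs, sq_abs, ← InnerProductSpace.toDual_symm_apply,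
                EuclideanSpace.inner_single_right]
              simp
            simp only [A]
            rw [← Finset.mul_sum, ← Finset.sum_mul, ← Finset.mul_sum, hnorm, mul_assoc (p ^ 2 / 4)]
            gcongr
      _ = _ := by
          rw [integral_const_mul, integral_add (hPi.const_mul _) ((hEi.div_const _).const_mul _),
            integral_const_mul, integral_const_mul, integral_div, h1]
          ring
  rw [add_sub_assoc]
  refine le_log_add_of_forall_le (by linarith) hp0 hκ (fun α c hα hc => ?_) hK
  have hNs : HasCompactSupport fun z => |v z| ^ p :=
    hvs.mono fun z hz hvz => hz (by simp [hvz, hp0.ne'])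
  have hPN : ∀ z, 0 < P z → 0 < |v z| ^ p := fun z hz => by
    have : v z ≠ 0 := fun h => hz.ne' (hPs z h)
    positivity
  have h := integral_mul_log_le_euclidean hι hPc hPcs hP0 h1 hNs
    (fun z => rpow_nonneg (abs_nonneg _) p) hPN hAc hAs hA0 hDc hNd hDA hα hc
    ((hFc.integrable_of_hasCompactSupport hFs).congr (.of_forall hFP))
  rwa [integral_congr_ae (.of_forall hFP)]

theorem integral_fderiv_apply_eq_zero {E : Type*} [NormedAddCommGroup E] [NormedSpace ℝ E]
    [MeasurableSpace E] [BorelSpace E] [FiniteDimensional ℝ E] (μ : Measure E) [μ.IsAddHaarMeasure]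
    {f : E → ℝ} (hf : ContDiff ℝ 1 f) (hfs : HasCompactSupport f) (w : E) :
    ∫ x, fderiv ℝ f x w ∂μ = 0 := by
  have hd : Continuous fun x => fderiv ℝ f x w :=
    (hf.continuous_fderiv one_ne_zero).clm_apply continuous_const
  have h := integral_mul_fderiv_eq_neg_fderiv_mul_of_integrable (μ := μ) (v := w)
    (f := fun _ : E => (1 : ℝ)) (g := f) (by simp)
    (by simpa using hd.integrable_of_hasCompactSupport (hfs.fderiv_apply ℝ w))
    (by simpa using hf.continuous.integrable_of_hasCompactSupport hfs)
    (fun x _ => differentiableAt_const _) (fun x _ => hf.differentiable one_ne_zero x)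
  simpa using h

/-- Pointwise form of the ground-state substitution `U = y ^ b * v` in the half-space. -/
theorem halfSpace_gradient_le {ι : Type*} [Fintype ι] {p : ℝ} (hp : 2 < p) {k b : ℝ}
    (hb : 0 ≤ b) (hbk : b * p = k - 1) {i₀ : ι} {v U : EuclideanSpace ℝ ι → ℝ}
    (z : EuclideanSpace ℝ ι) (hz : 0 < z i₀) (hv : DifferentiableAt ℝ v z)
    (hU : U =ᶠ[nhds z] fun w => w i₀ ^ b * v w) :
    b ^ p * (|v z| ^ p / z i₀) + b ^ (p - 1) * fderiv ℝ (fun w => |v w| ^ p) z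
        (EuclideanSpace.basisFun ι ℝ i₀) + 2 ^ (1 - p) * (z i₀ ^ (p - 1) * ‖fderiv ℝ v z‖ ^ p) ≤
      z i₀ ^ p * ‖fderiv ℝ U z‖ ^ p * z i₀ ^ (-k) := by
  classical
  have hp0 : 0 < p := by linarith
  set y := z i₀ with hy
  set e : EuclideanSpace ℝ ι := EuclideanSpace.basisFun ι ℝ i₀ with he
  have hen : ‖e‖ = 1 := (EuclideanSpace.basisFun ι ℝ).norm_eq_one i₀
  set g : EuclideanSpace ℝ ι := (InnerProductSpace.toDual ℝ _).symm (fderiv ℝ v z) with hg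
  have hgn : ‖g‖ = ‖fderiv ℝ v z‖ := LinearIsometryEquiv.norm_map _ _
  have hproj : HasFDerivAt (fun w : EuclideanSpace ℝ ι => w i₀) (EuclideanSpace.proj i₀ :
      EuclideanSpace ℝ ι →L[ℝ] ℝ) z :=
    (EuclideanSpace.proj i₀ : EuclideanSpace ℝ ι →L[ℝ] ℝ).hasFDerivAt
  have hUd : fderiv ℝ U z =
      InnerProductSpace.toDual ℝ _ (y ^ (b - 1) • ((b * v z) • e + y • g)) := by
    have h : HasFDerivAt (fun w : EuclideanSpace ℝ ι => w i₀ ^ b * v w) _ z :=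
      (hproj.rpow_const (.inl hz.ne')).mul hv.hasFDerivAt
    rw [hU.fderiv_eq, h.fderiv]
    ext w
    have : y ^ b = y ^ (b - 1) * y := by
      rw [← rpow_add_one hz.ne']; simp
    simp [hg, he, ← hy, this, EuclideanSpace.inner_single_left]
    ring
  rw [hUd, LinearIsometryEquiv.norm_map, norm_smul, norm_of_nonneg (rpow_nonneg hz.le _),
    mul_rpow (by positivity) (norm_nonneg _), ← rpow_mul hz.le]
  have h := add_norm_rpow_le hp.le ((b * v z) • e) (y • g)
  have hN : fderiv ℝ (fun w => |v w| ^ p) z e = p * |v z| ^ (p - 2) * v z * inner ℝ e g := by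
    rw [(hv.hasFDerivAt.abs_rpow (by linarith)).fderiv,
      real_inner_comm, hg, InnerProductSpace.toDual_symm_apply]
    rfl
  have hpow : y ^ p * (y ^ ((b - 1) * p) * ‖(b * v z) • e + y • g‖ ^ p) * y ^ (-k)
      = y⁻¹ * ‖(b * v z) • e + y • g‖ ^ p := by
    have : y ^ p * y ^ ((b - 1) * p) * y ^ (-k) = y⁻¹ := by
      rw [← rpow_add hz, ← rpow_add hz, ← rpow_neg_one]
      congr 1
      linarith
    rw [← this]; ring
  rw [hpow, hN]
  refine le_trans (le_of_eq ?_) (mul_le_mul_of_nonneg_left h (inv_nonneg.2 hz.le))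
  rw [norm_smul, norm_smul, hen, mul_one, norm_mul, norm_of_nonneg hb, norm_of_nonneg hz.le,
    norm_eq_abs, inner_smul_left, inner_smul_right, mul_rpow hb (abs_nonneg _),
    mul_rpow hb (abs_nonneg _), mul_rpow hz.le (norm_nonneg _), hgn,
    show p - 1 = (p - 2) + 1 by ring, rpow_add_one hz.ne']
  have hb1 : b ^ (p - 2 + 1) = b ^ (p - 2) * b := by
    rcases hb.eq_or_lt with h | h
    · rw [← h, mul_zero, zero_rpow (by linarith)]
    · rw [rpow_add_one h.ne']
  have hyp : y ^ p = y ^ (p - 2) * y * y := by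
    rw [← rpow_add_one hz.ne', ← rpow_add_one hz.ne']; congr 1; ring
  rw [hb1, hyp]
  simp only [conj_trivial]
  field_simp

/-- The Poincaré–Sobolev logarithmic inequality in the half-space model. -/
theorem halfSpace_log_sobolev {ι : Type*} [Fintype ι] (hι : 2 ≤ Fintype.card ι) {p : ℝ}
    (hp : 2 < p) (hpn : p ≤ Fintype.card ι)
    (i₀ : ι) {U : EuclideanSpace ℝ ι → ℝ} (hU : ContDiff ℝ 1 U) (hUs : HasCompactSupport U)
    (hpos : ∀ z ∈ tsupport U, 0 < z i₀)
    (h1 : ∫ z, |U z| ^ p * z i₀ ^ (-(Fintype.card ι : ℝ)) = 1) :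
    ∫ z, |U z| ^ p * log (|U z| ^ p) * z i₀ ^ (-(Fintype.card ι : ℝ)) ≤
      Fintype.card ι / p * log (logSobolevConst (Fintype.card ι) p *
        ((∫ z, z i₀ ^ p * ‖fderiv ℝ U z‖ ^ p * z i₀ ^ (-(Fintype.card ι : ℝ)))
          - ((Fintype.card ι - 1) / p) ^ p *
            ∫ z, |U z| ^ p * z i₀ ^ (-(Fintype.card ι : ℝ)))) := by
  have hn : (2 : ℝ) ≤ Fintype.card ι := by exact_mod_cast hι
  have hL := rpow_mul_two_rpow_le_logSobolevConst hp hpn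
  set k : ℝ := (Fintype.card ι : ℝ) with hk
  have hp0 : 0 < p := by linarith
  set b : ℝ := (k - 1) / p with hb
  have hb0 : 0 ≤ b := div_nonneg (by linarith) hp0.le
  have hbk : b * p = k - 1 := by rw [hb]; field_simp
  set v : EuclideanSpace ℝ ι → ℝ := fun z => z i₀ ^ (-b) * U z with hvdef
  have hUv : ∀ z, U z = 0 → v z = 0 := fun z hz => by simp [v, hz]
  have hvU : ∀ z : EuclideanSpace ℝ ι, 0 < z i₀ → U z = z i₀ ^ b * v z := fun z hz => by
    simp only [v]
    rw [← mul_assoc, ← rpow_add hz, add_neg_cancel, rpow_zero, one_mul]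
  have htv : tsupport v ⊆ tsupport U := tsupport_subset_of_imp hUv
  have hvs : HasCompactSupport v := hUs.mono fun z hz h => hz (hUv z h)
  have hv : ContDiff ℝ 1 v := contDiff_iff_contDiffAt.2 fun z => by
    by_cases hz : z ∈ tsupport U
    · have h : ContDiffAt ℝ 1 (fun w : EuclideanSpace ℝ ι => w i₀) z :=
        (EuclideanSpace.proj i₀ : EuclideanSpace ℝ ι →L[ℝ] ℝ).contDiff.contDiffAt
      exact (h.rpow_const_of_ne (hpos z hz).ne').mul hU.contDiffAt
    · refine contDiffAt_const (c := (0 : ℝ)) |>.congr_of_eventuallyEq ?_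
      filter_upwards [notMem_tsupport_iff_eventuallyEq.1 hz] with w hw using hUv w hw
  have hv0 : ∀ z : EuclideanSpace ℝ ι, z i₀ ≤ 0 → v z = 0 := fun z hz =>
    image_eq_zero_of_notMem_tsupport fun h => (hpos z (htv h)).not_ge hz
  have hU0 : ∀ z : EuclideanSpace ℝ ι, z i₀ ≤ 0 → U z = 0 := fun z hz =>
    image_eq_zero_of_notMem_tsupport fun h => (hpos z h).not_ge hz
  have hdU0 : ∀ z : EuclideanSpace ℝ ι, z i₀ ≤ 0 → fderiv ℝ U z = 0 := fun z hz =>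
    fderiv_of_notMem_tsupport _ fun h => (hpos z h).not_ge hz
  have hdv0 : ∀ z : EuclideanSpace ℝ ι, z i₀ ≤ 0 → fderiv ℝ v z = 0 := fun z hz =>
    fderiv_of_notMem_tsupport _ fun h => (hpos z (htv h)).not_ge hz
  have hvabs : ∀ z : EuclideanSpace ℝ ι, 0 < z i₀ → |v z| ^ p = z i₀ * (|U z| ^ p * z i₀ ^ (-k)) :=
    fun z hz => by
    simp only [v]
    rw [abs_mul, abs_of_nonneg (rpow_nonneg hz.le _), mul_rpow (by positivity) (abs_nonneg _),
      ← rpow_mul hz.le, show -b * p = -k + 1 by linarith, rpow_add_one hz.ne']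
    ring
  have hPU : ∀ z, |v z| ^ p / z i₀ = |U z| ^ p * z i₀ ^ (-k) := fun z => by
    rcases le_or_gt (z i₀) 0 with hz | hz
    · simp [hv0 z hz, hU0 z hz, hp0.ne']
    · rw [hvabs z hz]; field_simp
  have hEnt : ∀ z, |v z| ^ p / z i₀ * (log (|v z| ^ p) + (k - 1) * log (z i₀)) =
      |U z| ^ p * log (|U z| ^ p) * z i₀ ^ (-k) := fun z => by
    rcases eq_or_ne (U z) 0 with h | h
    · simp [hUv z h, h, hp0.ne']
    · have hz : 0 < z i₀ := not_le.1 fun hz => h (hU0 z hz)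
      rw [hPU, hvabs z hz, log_mul hz.ne' (by positivity), log_mul (by positivity) (by positivity),
        log_rpow hz]
      ring
  have key := fun κ (hκ : 0 < κ) => integral_halfSpace_mul_log_le hι hp i₀ hv hvs
    (fun z hz => hpos z (htv hz)) (by simpa only [hPU] using h1) hκ
  simp only [← hk, hEnt] at key
  set E : ℝ := ∫ z : EuclideanSpace ℝ ι, z i₀ ^ (p - 1) * ‖fderiv ℝ v z‖ ^ p
  set X : ℝ := ∫ z : EuclideanSpace ℝ ι, |U z| ^ p * log (|U z| ^ p) * z i₀ ^ (-k)
  set Δ : ℝ := (∫ z : EuclideanSpace ℝ ι, z i₀ ^ p * ‖fderiv ℝ U z‖ ^ p * z i₀ ^ (-k))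
          - b ^ p * ∫ z : EuclideanSpace ℝ ι, |U z| ^ p * z i₀ ^ (-k) with hΔ
  have hEΔ : E ≤ 2 ^ (p - 1) * Δ := by
    have hcoord : Continuous fun z : EuclideanSpace ℝ ι => z i₀ := by fun_prop
    have hUc := hU.continuous
    have hdUc := hU.continuous_fderiv one_ne_zero
    have hdvc := hv.continuous_fderiv one_ne_zero
    have hNc : ContDiff ℝ 1 fun z => |v z| ^ p :=
      (contDiff_norm_rpow (E := ℝ) (by linarith : 1 < p)).comp hv
    have hNs : HasCompactSupport fun z => |v z| ^ p :=
      hvs.mono fun z hz h => hz (by simp [h, hp0.ne'])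
    have hPs : HasCompactSupport fun z : EuclideanSpace ℝ ι => |U z| ^ p * z i₀ ^ (-k) :=
      hUs.mono fun z hz h => hz (by simp [h, hp0.ne'])
    have hPi : Integrable fun z : EuclideanSpace ℝ ι => |U z| ^ p * z i₀ ^ (-k) :=
      Continuous.integrable_of_hasCompactSupport
        (continuous_of_forall_pos (i₀ := i₀) (fun z hz => hpos z
          (tsupport_subset_of_imp (fun w h => by simp [h, hp0.ne']) hz)) fun z hz =>
          (hUc.abs.rpow_const fun _ => .inr hp0.le).continuousAt.mul
            (hcoord.continuousAt.rpow_const (.inl hz.ne'))) hPs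
    have hGi : Integrable fun z : EuclideanSpace ℝ ι =>
        z i₀ ^ p * ‖fderiv ℝ U z‖ ^ p * z i₀ ^ (-k) :=
      Continuous.integrable_of_hasCompactSupport
        (continuous_of_forall_pos (i₀ := i₀) (fun z hz => hpos z (tsupport_fderiv_subset ℝ
          (tsupport_subset_of_imp (fun w h => by simp [h, hp0.ne']) hz))) fun z hz =>
          ((hcoord.rpow_const fun _ => .inr hp0.le).mul
            (hdUc.norm.rpow_const fun _ => .inr hp0.le)).continuousAt.mul
              (hcoord.continuousAt.rpow_const (.inl hz.ne')))
        ((hUs.fderiv ℝ).mono fun z hz h => hz (by simp [h, hp0.ne']))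
    have hEi : Integrable fun z : EuclideanSpace ℝ ι => z i₀ ^ (p - 1) * ‖fderiv ℝ v z‖ ^ p :=
      ((hcoord.rpow_const fun _ => .inr (by linarith)).mul
        (hdvc.norm.rpow_const fun _ => .inr hp0.le)).integrable_of_hasCompactSupport
        ((hvs.fderiv ℝ).mono fun z hz h => hz (by simp [h, hp0.ne']))
    have hDi : Integrable fun z => fderiv ℝ (fun w => |v w| ^ p) z
        (EuclideanSpace.basisFun ι ℝ i₀) :=
      ((hNc.continuous_fderiv one_ne_zero).clm_apply
        continuous_const).integrable_of_hasCompactSupport (hNs.fderiv_apply ℝ _)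
    have hsum : Integrable fun z : EuclideanSpace ℝ ι => b ^ p * (|U z| ^ p * z i₀ ^ (-k))
        + b ^ (p - 1) * fderiv ℝ (fun w => |v w| ^ p) z (EuclideanSpace.basisFun ι ℝ i₀) :=
      (hPi.const_mul _).add (hDi.const_mul _)
    have h := integral_mono (hsum.add (hEi.const_mul (2 ^ (1 - p)))) hGi fun z => by
      rcases le_or_gt (z i₀) 0 with hz | hz
      · have : fderiv ℝ (fun w => |v w| ^ p) z = 0 := by
          rw [((hv.differentiable one_ne_zero z).hasFDerivAt.abs_rpow (by linarith)).fderiv,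
            hdv0 z hz, smul_zero]
        simp [hU0 z hz, hdU0 z hz, hdv0 z hz, this, hp0.ne']
      · have h := halfSpace_gradient_le hp hb0 hbk z hz (hv.differentiable one_ne_zero z)
          (U := U) (by
            filter_upwards [hcoord.continuousAt.eventually (lt_mem_nhds hz)] with w hw
              using hvU w hw)
        rwa [hPU] at h
    rw [integral_add' hsum (hEi.const_mul _), integral_add (hPi.const_mul _) (hDi.const_mul _),
      integral_const_mul, integral_const_mul, integral_const_mul,
      integral_fderiv_apply_eq_zero _ hNc hNs, mul_zero, add_zero] at h
    have h2 : (2 : ℝ) ^ (p - 1) * 2 ^ (1 - p) = 1 := by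
      rw [← rpow_add two_pos]; simp
    calc E = 2 ^ (p - 1) * (2 ^ (1 - p) * E) := by rw [← mul_assoc, h2, one_mul]
      _ ≤ 2 ^ (p - 1) * Δ := by
        gcongr
        linarith
  have hC : 0 < (p ^ 2 / (12 * k)) ^ (p / 2) := by positivity
  have hkp : 0 < k / p := by positivity
  rcases le_or_gt Δ 0 with h | h
  · exfalso
    have hE : E ≤ 0 := hEΔ.trans (mul_nonpos_of_nonneg_of_nonpos (by positivity) h)
    have h2 := key (exp (X / (k / p)) / (p ^ 2 / (12 * k)) ^ (p / 2)) (by positivity)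
    rw [mul_div_cancel₀ _ hC.ne', log_exp, mul_sub, mul_add, mul_div_cancel₀ _ hkp.ne'] at h2
    have h3 := mul_nonpos_of_nonneg_of_nonpos hkp.le (div_nonpos_of_nonpos_of_nonneg hE
      (show 0 ≤ exp (X / (k / p)) / (p ^ 2 / (12 * k)) ^ (p / 2) by positivity))
    linarith
  · have hκ : 0 < 2 ^ (p - 1) * Δ := by positivity
    refine (key _ hκ).trans (mul_le_mul_of_nonneg_left ?_ hkp.le)
    have h2 : E / (2 ^ (p - 1) * Δ) ≤ 1 := (div_le_one hκ).2 hEΔ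
    have h3 : log ((p ^ 2 / (12 * k)) ^ (p / 2) * (2 ^ (p - 1) * Δ)) ≤
        log (logSobolevConst (Fintype.card ι) p * Δ) := by
      refine log_le_log (by positivity) ?_
      rw [← mul_assoc]
      exact mul_le_mul_of_nonneg_right hL h.le
    linarith

/-- An inversion exchanging the Poincaré ball and the half-space `{z | 0 < z i₀}`. -/
noncomputable def ballInversion {ι : Type*} [Fintype ι] (i₀ : ι) :
    EuclideanSpace ℝ ι → EuclideanSpace ℝ ι :=
  EuclideanGeometry.inversion (-(EuclideanSpace.basisFun ι ℝ i₀)) √2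

section BallInversion

open EuclideanGeometry Metric

variable {ι : Type*} [Fintype ι] {i₀ : ι} {x z : EuclideanSpace ℝ ι}

theorem ballInversion_ballInversion (x : EuclideanSpace ℝ ι) :
    ballInversion i₀ (ballInversion i₀ x) = x :=
  inversion_inversion _ (by positivity) x

theorem ne_neg_basisFun_of_mem_ball (hx : x ∈ ball (0 : EuclideanSpace ℝ ι) 1) :
    x ≠ -(EuclideanSpace.basisFun ι ℝ i₀) := by
  rintro rfl
  simp at hx

theorem ne_neg_basisFun_of_nonneg (hz : 0 ≤ z i₀) : z ≠ -(EuclideanSpace.basisFun ι ℝ i₀) := by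
  classical
  rintro rfl
  simp at hz
  linarith

theorem ballInversion_apply_eq (hx : x ≠ -(EuclideanSpace.basisFun ι ℝ i₀)) :
    ballInversion i₀ x i₀ = (1 - ‖x‖ ^ 2) / dist x (-(EuclideanSpace.basisFun ι ℝ i₀)) ^ 2 := by
  classical
  have hd : dist x (-(EuclideanSpace.basisFun ι ℝ i₀)) ^ 2 = ‖x‖ ^ 2 + 2 * x i₀ + 1 := by
    rw [dist_eq_norm, sub_neg_eq_add, norm_add_sq_real, (EuclideanSpace.basisFun ι ℝ).norm_eq_one]
    have : inner ℝ x (EuclideanSpace.basisFun ι ℝ i₀) = x i₀ := by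
      rw [real_inner_comm, EuclideanSpace.basisFun_inner]
    rw [this, one_pow]
  have hne := dist_ne_zero.2 hx
  have h2 : √2 ^ 2 = (2 : ℝ) := Real.sq_sqrt (by norm_num)
  have : ballInversion i₀ x i₀ =
      (√2 / dist x (-(EuclideanSpace.basisFun ι ℝ i₀))) ^ 2 * (x i₀ + 1) - 1 := by
    simp [ballInversion, inversion, sub_eq_add_neg, mul_add]
  rw [this, div_pow, h2]
  field_simp
  rw [hd]
  ring

theorem ballInversion_pos_iff (hx : x ≠ -(EuclideanSpace.basisFun ι ℝ i₀)) :
    0 < ballInversion i₀ x i₀ ↔ x ∈ ball (0 : EuclideanSpace ℝ ι) 1 := by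
  have hd : 0 < dist x (-(EuclideanSpace.basisFun ι ℝ i₀)) := dist_pos.2 hx
  rw [ballInversion_apply_eq hx, div_pos_iff_of_pos_right (by positivity), mem_ball_zero_iff,
    sub_pos, sq_lt_one_iff₀ (norm_nonneg x)]

theorem ballInversion_mem_ball_iff :
    ballInversion i₀ z ∈ ball (0 : EuclideanSpace ℝ ι) 1 ↔ 0 < z i₀ := by
  have key : ballInversion i₀ z ≠ -(EuclideanSpace.basisFun ι ℝ i₀) →
      (0 < z i₀ ↔ ballInversion i₀ z ∈ ball (0 : EuclideanSpace ℝ ι) 1) := fun h => by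
    have := ballInversion_pos_iff h
    rwa [ballInversion_ballInversion] at this
  refine ⟨fun h => (key (ne_neg_basisFun_of_mem_ball h)).2 h, fun h => (key ?_).1 h⟩
  exact fun hc => ne_neg_basisFun_of_nonneg h.le ((inversion_eq_center (by positivity)).1 hc)

theorem ballInversion_image_ball :
    ballInversion i₀ '' ball (0 : EuclideanSpace ℝ ι) 1 = {z | 0 < z i₀} := by
  ext z
  constructor
  · rintro ⟨x, hx, rfl⟩
    exact (ballInversion_pos_iff (ne_neg_basisFun_of_mem_ball hx)).2 hx
  · exact fun hz => ⟨_, ballInversion_mem_ball_iff.2 hz, ballInversion_ballInversion z⟩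

theorem hasFDerivAt_ballInversion (hx : x ≠ -(EuclideanSpace.basisFun ι ℝ i₀)) :
    HasFDerivAt (ballInversion i₀) ((2 / dist x (-(EuclideanSpace.basisFun ι ℝ i₀)) ^ 2) •
      ((ℝ ∙ (x - -(EuclideanSpace.basisFun ι ℝ i₀)))ᗮ.reflection :
        EuclideanSpace ℝ ι →L[ℝ] EuclideanSpace ℝ ι)) x := by
  have h := hasFDerivAt_inversion (R := √2) hx
  rwa [div_pow, Real.sq_sqrt (by norm_num : (0 : ℝ) ≤ 2)] at h

/-- The hyperbolic volumes of the ball and of the half-space correspond under `ballInversion`. -/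
theorem integral_halfSpace_eq_integral_ball {g : EuclideanSpace ℝ ι → ℝ}
    (hg : ∀ z, z i₀ ≤ 0 → g z = 0) :
    ∫ z, g z * z i₀ ^ (-(Fintype.card ι : ℝ)) =
      ∫ x in ball (0 : EuclideanSpace ℝ ι) 1,
        g (ballInversion i₀ x) * (2 / (1 - ‖x‖ ^ 2)) ^ (Fintype.card ι : ℝ) := by
  rw [← setIntegral_eq_integral_of_forall_compl_eq_zero (s := {z : EuclideanSpace ℝ ι | 0 < z i₀})
      fun z hz => by rw [hg z (not_lt.1 hz), zero_mul], ← ballInversion_image_ball,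
    integral_image_eq_integral_abs_det_fderiv_smul volume measurableSet_ball
      (fun x hx => (hasFDerivAt_ballInversion
        (ne_neg_basisFun_of_mem_ball hx)).differentiableAt.hasFDerivAt.hasFDerivWithinAt)
      (Function.LeftInverse.injective ballInversion_ballInversion).injOn]
  refine setIntegral_congr_fun measurableSet_ball fun x hx => ?_
  have hne := ne_neg_basisFun_of_mem_ball (i₀ := i₀) hx
  set d := dist x (-(EuclideanSpace.basisFun ι ℝ i₀)) with hd
  have hd0 : 0 < d := dist_pos.2 hne
  have h1 : 0 < 1 - ‖x‖ ^ 2 := by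
    rw [sub_pos, sq_lt_one_iff₀ (norm_nonneg x)]
    exact mem_ball_zero_iff.1 hx
  have hdet : |((2 / d ^ 2) • ((ℝ ∙ (x - -(EuclideanSpace.basisFun ι ℝ i₀)))ᗮ.reflection :
        EuclideanSpace ℝ ι →L[ℝ] EuclideanSpace ℝ ι)).det| = (2 / d ^ 2) ^ Fintype.card ι := by
    have := Submodule.det_reflection (𝕜 := ℝ) (ℝ ∙ (x - -(EuclideanSpace.basisFun ι ℝ i₀)))ᗮ
    rw [ContinuousLinearMap.det, ContinuousLinearMap.toLinearMap_smul, LinearMap.det_smul,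
      finrank_euclideanSpace]
    erw [this]
    rw [abs_mul, abs_pow, abs_pow, abs_neg, abs_one, one_pow, mul_one,
      abs_of_nonneg (by positivity)]
  beta_reduce
  rw [smul_eq_mul, (hasFDerivAt_ballInversion hne).fderiv, hdet, ballInversion_apply_eq hne,
    ← hd, Real.rpow_neg (by positivity), Real.rpow_natCast,
    Real.rpow_natCast, mul_left_comm, ← inv_pow, ← mul_pow]
  congr 2
  field_simp

theorem apply_mul_norm_fderiv_ballInversion {U u : EuclideanSpace ℝ ι → ℝ}
    (hU : U = u ∘ ballInversion i₀) (hUd : Differentiable ℝ U)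
    (hx : x ∈ ball (0 : EuclideanSpace ℝ ι) 1) :
    ballInversion i₀ x i₀ * ‖fderiv ℝ U (ballInversion i₀ x)‖ =
      (1 - ‖x‖ ^ 2) / 2 * ‖fderiv ℝ u x‖ := by
  have hne := ne_neg_basisFun_of_mem_ball (i₀ := i₀) hx
  have hu : u = U ∘ ballInversion i₀ := by
    ext y
    simp [hU, ballInversion_ballInversion]
  have hd0 : 0 < dist x (-(EuclideanSpace.basisFun ι ℝ i₀)) := dist_pos.2 hne
  have h := ((hUd (ballInversion i₀ x)).hasFDerivAt.comp x (hasFDerivAt_ballInversion hne)).fderiv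
  rw [← hu, ContinuousLinearMap.comp_smul] at h
  have hR := (fderiv ℝ U (ballInversion i₀ x)).opNorm_comp_linearIsometryEquiv
    (ℝ ∙ (x - -(EuclideanSpace.basisFun ι ℝ i₀)))ᗮ.reflection
  have h2 := congrArg norm h
  rw [norm_smul, Real.norm_of_nonneg (by positivity)] at h2
  rw [h2, ballInversion_apply_eq hne, ← hR]
  field_simp

theorem contDiff_comp_ballInversion {u : EuclideanSpace ℝ ι → ℝ} (hu : ContDiff ℝ 1 u)
    (h0 : ∀ z : EuclideanSpace ℝ ι, z i₀ ≤ 0 → u (ballInversion i₀ z) = 0) :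
    ContDiff ℝ 1 (u ∘ ballInversion i₀) := by
  classical
  rw [contDiff_iff_contDiffAt]
  intro z
  by_cases hz : z = -(EuclideanSpace.basisFun ι ℝ i₀)
  · have : u ∘ ballInversion i₀ =ᶠ[nhds z] fun _ => 0 := by
      have ho : IsOpen {w : EuclideanSpace ℝ ι | w i₀ < 0} :=
        isOpen_lt (by fun_prop) continuous_const
      filter_upwards [ho.mem_nhds (by simp [hz])] with w hw using h0 w hw.le
    exact contDiffAt_const.congr_of_eventuallyEq this
  · exact hu.contDiffAt.comp z
      (ContDiffAt.inversion (n := 1) contDiffAt_const contDiffAt_const contDiffAt_id hz)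

theorem tsupport_comp_ballInversion_subset {u : EuclideanSpace ℝ ι → ℝ}
    (hs : tsupport u ⊆ ball (0 : EuclideanSpace ℝ ι) 1) :
    IsCompact (ballInversion i₀ '' tsupport u) ∧
      tsupport (u ∘ ballInversion i₀) ⊆ ballInversion i₀ '' tsupport u := by
  have hc : IsCompact (tsupport u) :=
    isCompact_of_isClosed_isBounded (isClosed_tsupport u) (isBounded_ball.subset hs)
  have hi : IsCompact (ballInversion i₀ '' tsupport u) :=
    hc.image_of_continuousOn fun x hx => (hasFDerivAt_ballInversion
      (ne_neg_basisFun_of_mem_ball (hs hx))).continuousAt.continuousWithinAt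
  refine ⟨hi, closure_minimal (fun z hz => ?_) hi.isClosed⟩
  exact ⟨ballInversion i₀ z, subset_tsupport u hz, ballInversion_ballInversion z⟩

end BallInversion

/-- The Poincaré–Sobolev logarithmic inequality in `ℍⁿ`. -/
theorem poincare_log_sobolev_hyperbolic (n : ℕ) (hn : 4 ≤ n) (p : ℝ)
    (hp1 : 2 * (n : ℝ) / ((n : ℝ) - 1) ≤ p) (hp2 : p < n)
    (u : EuclideanSpace ℝ (Fin n) → ℝ) (hu : ContDiff ℝ (⊤ : ℕ∞) u)
    (hsupp : tsupport u ⊆ Metric.ball (0 : EuclideanSpace ℝ (Fin n)) 1)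
    (hnorm : ∫ x in Metric.ball (0 : EuclideanSpace ℝ (Fin n)) 1,
        |u x| ^ p * (2 / (1 - ‖x‖ ^ 2)) ^ (n : ℝ) = 1) :
    ∫ x in Metric.ball (0 : EuclideanSpace ℝ (Fin n)) 1,
        |u x| ^ p * Real.log (|u x| ^ p) * (2 / (1 - ‖x‖ ^ 2)) ^ (n : ℝ)
      ≤ ((n : ℝ) / p) *
        Real.log (logSobolevConst n p *
          ((∫ x in Metric.ball (0 : EuclideanSpace ℝ (Fin n)) 1,
              ((1 - ‖x‖ ^ 2) / 2) ^ p * ‖fderiv ℝ u x‖ ^ p * (2 / (1 - ‖x‖ ^ 2)) ^ (n : ℝ))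
            - (((n : ℝ) - 1) / p) ^ p *
              ∫ x in Metric.ball (0 : EuclideanSpace ℝ (Fin n)) 1,
                |u x| ^ p * (2 / (1 - ‖x‖ ^ 2)) ^ (n : ℝ))) := by
  have hn' : (4 : ℝ) ≤ n := by exact_mod_cast hn
  have hp : 2 < p := by
    refine lt_of_lt_of_le ?_ hp1
    rw [lt_div_iff₀ (by linarith)]
    linarith
  have hp0 : p ≠ 0 := by linarith
  let i₀ : Fin n := ⟨0, by omega⟩
  set U := u ∘ ballInversion i₀ with hUdef
  have hUσ : ∀ x, U (ballInversion i₀ x) = u x := fun x => by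
    simp [hUdef, ballInversion_ballInversion]
  have h0 : ∀ z : EuclideanSpace ℝ (Fin n), z i₀ ≤ 0 → U z = 0 := fun z hz => by
    by_contra h
    exact hz.not_gt (ballInversion_mem_ball_iff.1 (hsupp (subset_tsupport u h)))
  have hU : ContDiff ℝ 1 U :=
    contDiff_comp_ballInversion (hu.of_le (by exact_mod_cast le_top)) h0
  obtain ⟨hK, hsub⟩ := tsupport_comp_ballInversion_subset (i₀ := i₀) hsupp
  have hpos : ∀ z ∈ tsupport U, 0 < z i₀ := fun z hz => by
    obtain ⟨x, hx, rfl⟩ := hsub hz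
    exact (ballInversion_pos_iff (ne_neg_basisFun_of_mem_ball (hsupp hx))).2 (hsupp hx)
  have hUs : HasCompactSupport U := hK.of_isClosed_subset (isClosed_tsupport U) hsub
  have e1 := integral_halfSpace_eq_integral_ball (i₀ := i₀) (g := fun z => |U z| ^ p)
    fun z hz => by simp [h0 z hz, hp0]
  have e2 := integral_halfSpace_eq_integral_ball (i₀ := i₀)
    (g := fun z => |U z| ^ p * log (|U z| ^ p)) fun z hz => by simp [h0 z hz, hp0]
  have e3 := integral_halfSpace_eq_integral_ball (i₀ := i₀)
    (g := fun z => z i₀ ^ p * ‖fderiv ℝ U z‖ ^ p) fun z hz => by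
      have : fderiv ℝ U z = 0 := image_eq_zero_of_notMem_tsupport fun h =>
        hz.not_gt (hpos z (tsupport_fderiv_subset ℝ h))
      simp [this, hp0]
  have e4 : ∀ x ∈ Metric.ball (0 : EuclideanSpace ℝ (Fin n)) 1,
      ballInversion i₀ x i₀ ^ p * ‖fderiv ℝ U (ballInversion i₀ x)‖ ^ p *
        (2 / (1 - ‖x‖ ^ 2)) ^ (n : ℝ) =
      ((1 - ‖x‖ ^ 2) / 2) ^ p * ‖fderiv ℝ u x‖ ^ p * (2 / (1 - ‖x‖ ^ 2)) ^ (n : ℝ) := by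
    intro x hx
    have hx1 : 0 ≤ (1 - ‖x‖ ^ 2) / 2 := by
      have := mem_ball_zero_iff.1 hx
      nlinarith [norm_nonneg x]
    have hx2 := (ballInversion_pos_iff (i₀ := i₀) (ne_neg_basisFun_of_mem_ball hx)).2 hx
    rw [← mul_rpow hx2.le (norm_nonneg _), ← mul_rpow hx1 (norm_nonneg _),
      apply_mul_norm_fderiv_ballInversion hUdef (hU.differentiable one_ne_zero) hx]
  simp only [hUσ, Fintype.card_fin] at e1 e2 e3
  rw [setIntegral_congr_fun measurableSet_ball e4] at e3
  have key := halfSpace_log_sobolev (ι := Fin n) (p := p) (by simp; omega) hp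
    (by simpa using hp2.le) i₀ hU hUs hpos (by simpa only [Fintype.card_fin, e1] using hnorm)
  simpa only [Fintype.card_fin, e1, e2, e3] using key
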